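/- For any integers r, s ≥ 2 and any integer k with 2 ≤ k ≤ r−1, the k-distance mutual-visibility number of the strong product of the path P_r with the complete graph K_s satisfies μ_k(P_r ⊠ K_s) = (k+1)(s−1) + 2. -/

import Mathlib

open SimpleGraph

/-- Two vertices `x, y` are `S_k`-visible in `G`: there is a shortest `x,y`-path of length
at most `k` none of whose internal vertices lies in `S`. -/
def SKVisible {V : Type*} (G : SimpleGraph V) (S : Set V) (k : ℕ) (x y : V) : Prop :=
  ∃ p : G.Walk x y, p.IsPath ∧ p.length = G.dist x y ∧ p.length ≤ k ∧
    ∀ v ∈ p.support, v ∈ S → v = x ∨ v = y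

/-- `S` is a `k`-distance mutual-visibility set of `G`. -/
def IsKDistMutualVisSet {V : Type*} (G : SimpleGraph V) (k : ℕ) (S : Set V) : Prop :=
  ∀ ⦃x⦄, x ∈ S → ∀ ⦃y⦄, y ∈ S → SKVisible G S k x y

/-- The `k`-distance mutual-visibility number `μ_k(G)`. -/
noncomputable def kdistMu {V : Type*} (G : SimpleGraph V) (k : ℕ) : ℕ :=
  sSup {n | ∃ S : Finset V, IsKDistMutualVisSet G k ↑S ∧ S.card = n}

/-- Two vertices `x, y` are `S`-visible in `G`. -/
def SVisible {V : Type*} (G : SimpleGraph V) (S : Set V) (x y : V) : Prop :=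
  ∃ p : G.Walk x y, p.IsPath ∧ p.length = G.dist x y ∧
    ∀ v ∈ p.support, v ∈ S → v = x ∨ v = y

/-- `S` is a mutual-visibility set of `G`. -/
def IsMutualVisSet {V : Type*} (G : SimpleGraph V) (S : Set V) : Prop :=
  ∀ ⦃x⦄, x ∈ S → ∀ ⦃y⦄, y ∈ S → SVisible G S x y

/-- The mutual-visibility number `μ(G)`. -/
noncomputable def mutualVisNum {V : Type*} (G : SimpleGraph V) : ℕ :=
  sSup {n | ∃ S : Finset V, IsMutualVisSet G ↑S ∧ S.card = n}

/-- The strong product of two simple graphs. -/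
def strongProd {α β : Type*} (G : SimpleGraph α) (H : SimpleGraph β) :
    SimpleGraph (α × β) :=
  SimpleGraph.fromRel (fun x y =>
    (x.1 = y.1 ∧ H.Adj x.2 y.2) ∨ (x.2 = y.2 ∧ G.Adj x.1 y.1) ∨
    (G.Adj x.1 y.1 ∧ H.Adj x.2 y.2))

theorem strongProd_pathGraph_top_adj {r s : ℕ} (x y : Fin r × Fin s) :
    (strongProd (pathGraph r) (⊤ : SimpleGraph (Fin s))).Adj x y ↔
      x ≠ y ∧ (x.1 : ℕ) ≤ y.1 + 1 ∧ (y.1 : ℕ) ≤ x.1 + 1 := by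
  obtain ⟨a, b⟩ := x
  obtain ⟨c, d⟩ := y
  simp only [strongProd, fromRel_adj, pathGraph_adj, top_adj, ne_eq, Prod.mk.injEq, Fin.ext_iff]
  grind

theorem fst_le_fst_add_length {r s : ℕ} {x y : Fin r × Fin s}
    (p : (strongProd (pathGraph r) (⊤ : SimpleGraph (Fin s))).Walk x y) :
    (y.1 : ℕ) ≤ x.1 + p.length := by
  induction p with
  | nil => simp
  | cons h p ih =>
    have := ((strongProd_pathGraph_top_adj _ _).1 h).2
    rw [Walk.length_cons]
    omega

theorem exists_mem_support_fst_eq {r s : ℕ} {x y : Fin r × Fin s}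
    (p : (strongProd (pathGraph r) (⊤ : SimpleGraph (Fin s))).Walk x y) (c : Fin r)
    (hx : x.1 ≤ c) (hy : c ≤ y.1) : ∃ v ∈ p.support, v.1 = c := by
  induction p with
  | nil => exact ⟨_, Walk.start_mem_support _, le_antisymm hx hy⟩
  | @cons u v w h p ih =>
    rcases hx.eq_or_lt with hx | hx
    · exact ⟨u, Walk.start_mem_support _, hx⟩
    · have := ((strongProd_pathGraph_top_adj _ _).1 h).2
      obtain ⟨z, hz, rfl⟩ := ih (by rw [Fin.le_def]; rw [Fin.lt_def] at hx; omega) hy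
      exact ⟨z, List.mem_cons_of_mem _ hz, rfl⟩

theorem exists_walk_through_layer {r s : ℕ} (b : Fin s) (d : ℕ) :
    ∀ x y : Fin r × Fin s, (y.1 : ℕ) = x.1 + (d + 1) →
      ∃ p : (strongProd (pathGraph r) (⊤ : SimpleGraph (Fin s))).Walk x y,
        p.length = d + 1 ∧
          ∀ v ∈ p.support, v = x ∨ v = y ∨ (x.1 < v.1 ∧ v.1 < y.1 ∧ v.2 = b) := by
  induction d with
  | zero =>
    intro x y h
    have hadj : (strongProd (pathGraph r) (⊤ : SimpleGraph (Fin s))).Adj x y := by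
      rw [strongProd_pathGraph_top_adj]
      refine ⟨?_, by omega, by omega⟩
      rintro rfl
      omega
    refine ⟨hadj.toWalk, rfl, fun v hv => ?_⟩
    simp at hv
    tauto
  | succ d ih =>
    intro x y h
    let z : Fin r × Fin s := (⟨x.1 + 1, by omega⟩, b)
    have hz : (z.1 : ℕ) = x.1 + 1 := rfl
    have hadj : (strongProd (pathGraph r) (⊤ : SimpleGraph (Fin s))).Adj x z := by
      rw [strongProd_pathGraph_top_adj]
      refine ⟨fun e => ?_, by omega, by omega⟩
      rw [← e] at hz
      omega
    obtain ⟨p, hp, hsupp⟩ := ih z y (by omega)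
    refine ⟨.cons hadj p, by simp [hp], fun v hv => ?_⟩
    rw [Walk.support_cons, List.mem_cons] at hv
    rcases hv with rfl | hv
    · exact .inl rfl
    rcases hsupp v hv with rfl | rfl | ⟨h1, h2, h3⟩
    · exact .inr (.inr ⟨by rw [Fin.lt_def]; omega, by rw [Fin.lt_def]; omega, rfl⟩)
    · exact .inr (.inl rfl)
    · exact .inr (.inr ⟨by rw [Fin.lt_def] at *; omega, h2, h3⟩)

theorem SKVisible.symm {V : Type*} {G : SimpleGraph V} {S : Set V} {k : ℕ} {x y : V}
    (h : SKVisible G S k x y) : SKVisible G S k y x := by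
  obtain ⟨p, hp, hd, hk, hS⟩ := h
  refine ⟨p.reverse, hp.reverse, by rw [Walk.length_reverse, hd, dist_comm], by simpa, ?_⟩
  intro v hv hvS
  exact (hS v (by simpa using hv) hvS).symm

theorem skVisible_of_fst_lt {r s k : ℕ} {S : Set (Fin r × Fin s)} (b : Fin s)
    {x y : Fin r × Fin s} (hxy : x.1 < y.1) (hk : (y.1 : ℕ) ≤ x.1 + k)
    (hS : ∀ v ∈ S, x.1 < v.1 → v.1 < y.1 → v.2 ≠ b) :
    SKVisible (strongProd (pathGraph r) (⊤ : SimpleGraph (Fin s))) S k x y := by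
  rw [Fin.lt_def] at hxy
  obtain ⟨d, hd⟩ : ∃ d, (y.1 : ℕ) = x.1 + (d + 1) := ⟨y.1 - x.1 - 1, by omega⟩
  obtain ⟨p, hp, hsupp⟩ := exists_walk_through_layer b d x y hd
  have hdist : p.length
      = (strongProd (pathGraph r) (⊤ : SimpleGraph (Fin s))).dist x y := by
    refine le_antisymm ?_ (dist_le p)
    obtain ⟨q, hq⟩ := p.reachable.exists_walk_length_eq_dist
    have := fst_le_fst_add_length q
    omega
  refine ⟨p, p.isPath_of_length_eq_dist hdist, hdist, by omega, fun v hv hvS => ?_⟩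
  rcases hsupp v hv with h | h | ⟨h1, h2, h3⟩
  · exact .inl h
  · exact .inr h
  · exact absurd h3 (hS v hvS h1 h2)

theorem skVisible_of_fst_eq {r s k : ℕ} {S : Set (Fin r × Fin s)} (hk : 1 ≤ k)
    {x y : Fin r × Fin s} (hxy : x.1 = y.1) :
    SKVisible (strongProd (pathGraph r) (⊤ : SimpleGraph (Fin s))) S k x y := by
  by_cases h : x = y
  · subst h
    exact ⟨.nil, .nil, by simp, by simp, by simp⟩
  · have hadj : (strongProd (pathGraph r) (⊤ : SimpleGraph (Fin s))).Adj x y := by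
      rw [strongProd_pathGraph_top_adj, hxy]
      exact ⟨h, by omega, by omega⟩
    have hdist : hadj.toWalk.length
        = (strongProd (pathGraph r) (⊤ : SimpleGraph (Fin s))).dist x y :=
      (dist_eq_one_iff_adj.2 hadj).symm
    exact ⟨hadj.toWalk, hadj.toWalk.isPath_of_length_eq_dist hdist, hdist, hk, by simp⟩

theorem exists_isKDistMutualVisSet_card_eq (r s k : ℕ) (hs : 2 ≤ s) (hk2 : 2 ≤ k)
    (hkr : k < r) :
    ∃ S : Finset (Fin r × Fin s),
      IsKDistMutualVisSet (strongProd (pathGraph r) (⊤ : SimpleGraph (Fin s))) k ↑S ∧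
        S.card = (k + 1) * (s - 1) + 2 := by
  let o : Fin r := ⟨0, by omega⟩
  let a : Fin r := ⟨k, hkr⟩
  let b : Fin s := ⟨0, by omega⟩
  have hoa : ∀ c : Fin r, o ≤ c := fun c => Nat.zero_le _
  refine ⟨Finset.Iic a ×ˢ Finset.univ \ Finset.Ioo o a ×ˢ {b}, ?_, ?_⟩
  · have key : ∀ x y : Fin r × Fin s, y.1 ≤ a → x.1 < y.1 →
        SKVisible (strongProd (pathGraph r) (⊤ : SimpleGraph (Fin s)))
          ↑(Finset.Iic a ×ˢ Finset.univ \ Finset.Ioo o a ×ˢ {b}) k x y := by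
      intro x y hy hxy
      refine skVisible_of_fst_lt b hxy (by have : (y.1 : ℕ) ≤ k := hy; omega) ?_
      intro v hv h1 h2 h3
      simp only [Finset.coe_sdiff, Set.mem_sdiff, Finset.mem_coe, Finset.mem_product,
        Finset.mem_Ioo, Finset.mem_singleton] at hv
      exact hv.2 ⟨⟨(hoa _).trans_lt h1, h2.trans_le hy⟩, h3⟩
    intro x hx y hy
    simp only [Finset.coe_sdiff, Set.mem_sdiff, Finset.mem_coe, Finset.mem_product,
      Finset.mem_Iic] at hx hy
    rcases lt_trichotomy x.1 y.1 with h | h | h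
    · exact key x y hy.1.1 h
    · exact skVisible_of_fst_eq (by omega) h
    · exact (key y x hx.1.1 h).symm
  · have hsub : Finset.Ioo o a ×ˢ {b} ⊆ Finset.Iic a ×ˢ (Finset.univ : Finset (Fin s)) :=
      Finset.product_subset_product
        (fun c hc => Finset.mem_Iic.2 (Finset.mem_Ioo.1 hc).2.le) (Finset.subset_univ _)
    rw [Finset.card_sdiff_of_subset hsub, Finset.card_product, Finset.card_product,
      Fin.card_Iic, Fin.card_Ioo, Finset.card_singleton, Finset.card_univ, Fintype.card_fin]
    obtain ⟨t, rfl⟩ : ∃ t, s = t + 1 := ⟨s - 1, by omega⟩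
    simp only [o, a, Nat.add_sub_cancel, Nat.mul_succ]
    omega

theorem IsKDistMutualVisSet.card_le {r s k : ℕ} (hs : 1 ≤ s)
    {S : Finset (Fin r × Fin s)}
    (hS : IsKDistMutualVisSet (strongProd (pathGraph r) (⊤ : SimpleGraph (Fin s))) k ↑S) :
    S.card ≤ (k + 1) * (s - 1) + 2 := by
  rcases S.eq_empty_or_nonempty with rfl | hne
  · simp
  obtain ⟨x, hx, hmin⟩ := S.exists_min_image Prod.fst hne
  obtain ⟨y, hy, hmax⟩ := S.exists_max_image Prod.fst hne
  obtain ⟨p, -, -, hpk, hp⟩ := hS hx hy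
  have hlen := fst_le_fst_add_length p
  have hxy : (x.1 : ℕ) ≤ y.1 := hmin y hy
  have hex : ∀ c : Fin r, ∃ v : Fin r × Fin s, c ∈ Finset.Ioo x.1 y.1 → v ∉ S ∧ v.1 = c := by
    intro c
    by_cases hc : c ∈ Finset.Ioo x.1 y.1
    · have hc' := Finset.mem_Ioo.1 hc
      obtain ⟨v, hv, rfl⟩ := exists_mem_support_fst_eq p c hc'.1.le hc'.2.le
      refine ⟨v, fun _ => ⟨fun hvS => ?_, rfl⟩⟩
      rcases hp v hv hvS with rfl | rfl
      · exact lt_irrefl _ hc'.1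
      · exact lt_irrefl _ hc'.2
    · exact ⟨x, fun h => absurd h hc⟩
  choose f hf using hex
  have hcard : ((Finset.Ioo x.1 y.1).image f).card = (Finset.Ioo x.1 y.1).card := by
    refine Finset.card_image_of_injOn fun c hc d hd h => ?_
    rw [← (hf c hc).2, ← (hf d hd).2, h]
  have hdisj : Disjoint S ((Finset.Ioo x.1 y.1).image f) := by
    rw [Finset.disjoint_right]
    intro v hv
    obtain ⟨c, hc, rfl⟩ := Finset.mem_image.1 hv
    exact (hf c hc).1
  have hsub : S ∪ (Finset.Ioo x.1 y.1).image f ⊆ Finset.Icc x.1 y.1 ×ˢ Finset.univ := by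
    refine Finset.union_subset (fun v hv => ?_) (fun v hv => ?_)
    · simpa using And.intro (hmin v hv) (hmax v hv)
    · obtain ⟨c, hc, rfl⟩ := Finset.mem_image.1 hv
      have := Finset.Ioo_subset_Icc_self hc
      simpa [(hf c hc).2] using this
  have hle := Finset.card_le_card hsub
  rw [Finset.card_union_of_disjoint hdisj, hcard, Finset.card_product, Fin.card_Ioo,
    Fin.card_Icc, Finset.card_univ, Fintype.card_fin] at hle
  obtain ⟨t, rfl⟩ : ∃ t, s = t + 1 := ⟨s - 1, by omega⟩
  obtain ⟨d, hd⟩ : ∃ d, (y.1 : ℕ) = x.1 + d := ⟨y.1 - x.1, by omega⟩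
  have hmul : (d + 1) * t ≤ (k + 1) * t := Nat.mul_le_mul_right t (by omega)
  rw [hd, show (x.1 : ℕ) + d + 1 - x.1 = d + 1 by omega, Nat.mul_succ] at hle
  rw [Nat.add_sub_cancel]
  omega

/-- For `r, s ≥ 2` and `2 ≤ k ≤ r - 1`, `μ_k(P_r ⊠ K_s) = (k+1)(s-1) + 2`. -/
theorem stmt3 (r s k : ℕ) (hr : 2 ≤ r) (hs : 2 ≤ s) (hk2 : 2 ≤ k) (hkr : k ≤ r - 1) :
    kdistMu (strongProd (SimpleGraph.pathGraph r) (⊤ : SimpleGraph (Fin s))) k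
      = (k + 1) * (s - 1) + 2 := by
  have hub : ∀ n ∈ {n | ∃ S : Finset (Fin r × Fin s),
      IsKDistMutualVisSet (strongProd (pathGraph r) (⊤ : SimpleGraph (Fin s))) k ↑S ∧
        S.card = n}, n ≤ (k + 1) * (s - 1) + 2 := by
    rintro n ⟨S, hS, rfl⟩
    exact hS.card_le (by omega)
  exact IsGreatest.csSup_eq
    ⟨exists_isKDistMutualVisSet_card_eq r s k hs hk2 (by omega), hub⟩
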